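/- Let ν ≥ 0 and let (u, θ) be a smooth solution of the regularized thermoelasticity system on [0,T]. Then for every t ∈ [0,T]: (d/dt) ( (1/2) ∫_a^b θ(t,x)² dx ) + ∫_a^b θ_x(t,x)² dx = −μ ∫_a^b θ(t,x)² u_tx(t,x) dx = 2μ ∫_a^b θ_x(t,x) θ(t,x) u_t(t,x) dx. -/

import Mathlib

open Set MeasureTheory

/-- Partial derivative in the first (time) variable. -/
noncomputable def pt (w : ℝ → ℝ → ℝ) (t x : ℝ) : ℝ := deriv (fun s => w s x) t

/-- Partial derivative in the second (space) variable. -/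
noncomputable def px (w : ℝ → ℝ → ℝ) (t x : ℝ) : ℝ := deriv (fun y => w t y) x

/-- Square of the L² norm on (a,b). -/
noncomputable def sqInt (a b : ℝ) (f : ℝ → ℝ) : ℝ := ∫ x in a..b, (f x) ^ 2

/-- The L² norm on (a,b). -/
noncomputable def L2norm (a b : ℝ) (f : ℝ → ℝ) : ℝ := Real.sqrt (sqInt a b f)

/-- A smooth solution of the regularized thermoelasticity system on [0,T] × [a,b]:
`u_tt − u_xx − ν u_txx = −μ θ_x`, `θ_t − θ_xx + μ θ u_tx = 0`,
with Dirichlet boundary conditions for `u` and Neumann boundary conditions for `θ`. -/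
def IsRegSolution (a b μ T ν : ℝ) (u θ : ℝ → ℝ → ℝ) : Prop :=
  ContDiff ℝ (⊤ : ℕ∞) (Function.uncurry u) ∧ ContDiff ℝ (⊤ : ℕ∞) (Function.uncurry θ) ∧
  (∀ t ∈ Set.Icc (0:ℝ) T, ∀ x ∈ Set.Icc a b,
      pt (pt u) t x - px (px u) t x - ν * px (px (pt u)) t x = -μ * px θ t x) ∧
  (∀ t ∈ Set.Icc (0:ℝ) T, ∀ x ∈ Set.Icc a b,
      pt θ t x - px (px θ) t x + μ * θ t x * px (pt u) t x = 0) ∧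
  (∀ t ∈ Set.Icc (0:ℝ) T, u t a = 0 ∧ u t b = 0) ∧
  (∀ t ∈ Set.Icc (0:ℝ) T, px θ t a = 0 ∧ px θ t b = 0)

section PartialDerivatives

variable {w : ℝ → ℝ → ℝ}

theorem hasDerivAt_fst_of_contDiff (hw : ContDiff ℝ (⊤ : ℕ∞) (Function.uncurry w)) (t x : ℝ) :
    HasDerivAt (fun s => w s x) (fderiv ℝ (Function.uncurry w) (t, x) (1, 0)) t :=
  HasFDerivAt.comp_hasDerivAt (l := Function.uncurry w) t
    ((hw.differentiable (by simp)) (t, x)).hasFDerivAt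
    ((hasDerivAt_id t).prodMk (hasDerivAt_const t x))

theorem hasDerivAt_snd_of_contDiff (hw : ContDiff ℝ (⊤ : ℕ∞) (Function.uncurry w)) (t x : ℝ) :
    HasDerivAt (fun y => w t y) (fderiv ℝ (Function.uncurry w) (t, x) (0, 1)) x :=
  HasFDerivAt.comp_hasDerivAt (l := Function.uncurry w) x
    ((hw.differentiable (by simp)) (t, x)).hasFDerivAt
    ((hasDerivAt_const x t).prodMk (hasDerivAt_id x))

theorem hasDerivAt_pt (hw : ContDiff ℝ (⊤ : ℕ∞) (Function.uncurry w)) (t x : ℝ) :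
    HasDerivAt (fun s => w s x) (pt w t x) t :=
  (hasDerivAt_fst_of_contDiff hw t x).differentiableAt.hasDerivAt

theorem hasDerivAt_px (hw : ContDiff ℝ (⊤ : ℕ∞) (Function.uncurry w)) (t x : ℝ) :
    HasDerivAt (fun y => w t y) (px w t x) x :=
  (hasDerivAt_snd_of_contDiff hw t x).differentiableAt.hasDerivAt

theorem contDiff_uncurry_pt (hw : ContDiff ℝ (⊤ : ℕ∞) (Function.uncurry w)) :
    ContDiff ℝ (⊤ : ℕ∞) (Function.uncurry (pt w)) := by
  have h : Function.uncurry (pt w) = fun p => fderiv ℝ (Function.uncurry w) p (1, 0) :=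
    funext fun p => (hasDerivAt_fst_of_contDiff hw p.1 p.2).deriv
  rw [h]
  exact (hw.fderiv_right (by simp)).clm_apply contDiff_const

theorem contDiff_uncurry_px (hw : ContDiff ℝ (⊤ : ℕ∞) (Function.uncurry w)) :
    ContDiff ℝ (⊤ : ℕ∞) (Function.uncurry (px w)) := by
  have h : Function.uncurry (px w) = fun p => fderiv ℝ (Function.uncurry w) p (0, 1) :=
    funext fun p => (hasDerivAt_snd_of_contDiff hw p.1 p.2).deriv
  rw [h]
  exact (hw.fderiv_right (by simp)).clm_apply contDiff_const

theorem continuous_slice (hw : ContDiff ℝ (⊤ : ℕ∞) (Function.uncurry w)) (t : ℝ) :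
    Continuous (w t) :=
  hw.continuous.comp (Continuous.prodMk_right t)

/-- A smooth function vanishing for `t ∈ [0,T]` at a fixed `x` has vanishing time derivative there,
endpoints included. -/
theorem pt_eq_zero_of_eq_zero_on_Icc (hw : ContDiff ℝ (⊤ : ℕ∞) (Function.uncurry w)) {T x t : ℝ}
    (hT : 0 < T) (h : ∀ s ∈ Icc (0:ℝ) T, w s x = 0) (ht : t ∈ Icc (0:ℝ) T) : pt w t x = 0 := by
  have hzero : HasDerivWithinAt (fun s => w s x) 0 (Icc 0 T) t :=
    (hasDerivWithinAt_const t (Icc 0 T) (0 : ℝ)).congr h (h t ht)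
  exact (uniqueDiffOn_Icc hT t ht).eq_deriv _ (hasDerivAt_pt hw t x).hasDerivWithinAt hzero

/-- Differentiation of the integral of a smooth function over a fixed interval. -/
theorem hasDerivAt_intervalIntegral_of_contDiff (hw : ContDiff ℝ (⊤ : ℕ∞) (Function.uncurry w))
    (a b t : ℝ) :
    HasDerivAt (fun s => ∫ x in a..b, w s x) (∫ x in a..b, pt w t x) t := by
  have hpt := contDiff_uncurry_pt hw
  obtain ⟨C, hC⟩ := ((isCompact_Icc (a := t - 1) (b := t + 1)).prod
    (isCompact_uIcc (a := a) (b := b))).exists_bound_of_continuousOn hpt.continuous.continuousOn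
  refine (intervalIntegral.hasDerivAt_integral_of_dominated_loc_of_deriv_le
    (bound := fun _ => C) (Icc_mem_nhds (sub_one_lt t) (lt_add_one t))
    (Filter.Eventually.of_forall fun s => (continuous_slice hw s).aestronglyMeasurable)
    ((continuous_slice hw t).intervalIntegrable a b)
    (continuous_slice hpt t).aestronglyMeasurable
    (Filter.Eventually.of_forall fun x hx s hs => ?_) intervalIntegrable_const
    (Filter.Eventually.of_forall fun x _ s _ => hasDerivAt_pt hw s x)).2
  exact hC (s, x) ⟨hs, uIoc_subset_uIcc hx⟩

end PartialDerivatives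

/-- **L² energy identity for the temperature equation**: for every `t ∈ [0,T]`,
`(d/dt)((1/2)∫ θ(t)²) + ∫ θ_x(t)² = −μ ∫ θ(t)² u_tx(t) = 2μ ∫ θ_x(t) θ(t) u_t(t)`. -/
theorem temperature_L2_identity (a b μ T ν : ℝ) (hab : a < b) (hμ : 0 < μ) (hT : 0 < T)
    (hν : 0 ≤ ν) (u θ : ℝ → ℝ → ℝ) (hsol : IsRegSolution a b μ T ν u θ) :
    ∀ t ∈ Icc (0:ℝ) T,
      (deriv (fun s => (1/2) * ∫ x in a..b, θ s x ^ 2) t + ∫ x in a..b, px θ t x ^ 2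
          = -μ * ∫ x in a..b, θ t x ^ 2 * px (pt u) t x) ∧
      (-μ * (∫ x in a..b, θ t x ^ 2 * px (pt u) t x)
          = 2 * μ * ∫ x in a..b, px θ t x * θ t x * pt u t x) := by
  intro t ht
  obtain ⟨hu, hθ, -, heat, hDir, hNeu⟩ := hsol
  have hut := contDiff_uncurry_pt hu
  have hθx := contDiff_uncurry_px hθ
  have cθ := continuous_slice hθ t
  have cθx := continuous_slice hθx t
  have cθxx := continuous_slice (contDiff_uncurry_px hθx) t
  have cutx := continuous_slice (contDiff_uncurry_px hut) t
  have hsq (s x : ℝ) : pt (fun s x => θ s x ^ 2) s x = 2 * θ s x * pt θ s x := by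
    simpa [pt] using ((hasDerivAt_pt hθ s x).fun_pow 2).deriv
  have hderiv : deriv (fun s => (1/2) * ∫ x in a..b, θ s x ^ 2) t
      = ∫ x in a..b, θ t x * pt θ t x := by
    rw [((hasDerivAt_intervalIntegral_of_contDiff (w := fun s x => θ s x ^ 2)
      (hθ.pow 2) a b t).const_mul (1/2)).deriv, ← intervalIntegral.integral_const_mul]
    refine intervalIntegral.integral_congr fun x _ => ?_
    simp only [hsq]
    ring
  have hsubst : ∫ x in a..b, θ t x * pt θ t x
      = (∫ x in a..b, θ t x * px (px θ) t x) - μ * ∫ x in a..b, θ t x ^ 2 * px (pt u) t x := by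
    rw [← intervalIntegral.integral_const_mul, ← intervalIntegral.integral_sub
      (Continuous.intervalIntegrable (by fun_prop) a b)
      (Continuous.intervalIntegrable (by fun_prop) a b)]
    refine intervalIntegral.integral_congr fun x hx => ?_
    rw [uIcc_of_le hab.le] at hx
    linear_combination θ t x * heat t ht x hx
  have hdiffusion : ∫ x in a..b, θ t x * px (px θ) t x = -∫ x in a..b, px θ t x ^ 2 := by
    rw [intervalIntegral.integral_mul_deriv_eq_deriv_mul (fun x _ => hasDerivAt_px hθ t x)
      (fun x _ => hasDerivAt_px hθx t x) (cθx.intervalIntegrable a b)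
      (cθxx.intervalIntegrable a b), (hNeu t ht).1, (hNeu t ht).2]
    simp [pow_two]
  have hcoupling : ∫ x in a..b, θ t x ^ 2 * px (pt u) t x
      = -(2 * ∫ x in a..b, px θ t x * θ t x * pt u t x) := by
    rw [intervalIntegral.integral_mul_deriv_eq_deriv_mul (u' := fun x => 2 * θ t x * px θ t x)
      (fun x _ => by simpa using (hasDerivAt_px hθ t x).fun_pow 2)
      (fun x _ => hasDerivAt_px hut t x)
      (((continuous_const.mul cθ).mul cθx).intervalIntegrable a b)
      (cutx.intervalIntegrable a b),
      pt_eq_zero_of_eq_zero_on_Icc hu hT (fun s hs => (hDir s hs).1) ht,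
      pt_eq_zero_of_eq_zero_on_Icc hu hT (fun s hs => (hDir s hs).2) ht,
      ← intervalIntegral.integral_const_mul]
    simp only [mul_zero, sub_zero, zero_sub]
    congr 1
    refine intervalIntegral.integral_congr fun x _ => ?_
    ring
  constructor
  · rw [hderiv, hsubst, hdiffusion]
    ring
  · rw [hcoupling]
    ring
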